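/- Let m be a natural number and let R₀ and R₁ be analytic subsets of ℝ^m × ℝ^m which are contradictory, i.e. for every b ∈ ℝ^m there is no a ∈ ℝ^m with (a,b) ∈ R₀ and (a,b) ∈ R₁. Suppose there exist a linear order J of cardinality at least ℵ_{ω₁} and elements a_t ∈ ℝ^m for t ∈ J such that s < t in J implies (a_s, a_t) ∈ R₀ and (a_t, a_s) ∈ R₁. Then there exist elements a_η ∈ ℝ^m for η ∈ 2^ω and b_ν ∈ ℝ^m for ν ∈ 2^{<ω} such that for every ν ∈ 2^{<ω}, every i ∈ {0,1}, and every η ∈ 2^ω extending ν⌢⟨i⟩, one has (a_η, b_ν) ∈ R_i; in particular the a_η for η ∈ 2^ω are pairwise distinct. -/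

import Mathlib

open MeasureTheory Cardinal

universe u

/-- Points of `S` with fewer than `κ` predecessors in `S` number at most `κ`. -/
theorem mk_setOf_mk_predecessors_lt_le {J : Type u} [LinearOrder J] (S : Set J) {κ : Cardinal.{u}}
    (hκ : ℵ₀ ≤ κ) : #{t | t ∈ S ∧ #{s | s ∈ S ∧ s < t} < κ} ≤ κ := by
  by_contra! hlt
  set L : Set J := {t | t ∈ S ∧ #{s | s ∈ S ∧ s < t} < κ} with hL
  obtain ⟨T, hTL, hT⟩ := le_mk_iff_exists_subset.1 hlt.le
  by_cases hcof : ∃ t ∈ L, ∀ x ∈ T, x < t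
  · obtain ⟨t, ht, hTt⟩ := hcof
    refine absurd ht.2 (not_lt.2 ?_)
    rw [← hT]
    exact mk_le_mk_of_subset fun x hx => ⟨(hTL hx).1, hTt x hx⟩
  · push Not at hcof
    have hcov : L ⊆ ⋃ x : T, (insert (x : J) {s | s ∈ S ∧ s < (x : J)}) := by
      intro t ht
      obtain ⟨x, hx, htx⟩ := hcof t ht
      refine Set.mem_iUnion.2 ⟨⟨x, hx⟩, ?_⟩
      rcases htx.eq_or_lt with h | h
      · exact Or.inl h
      · exact Or.inr ⟨ht.1, h⟩
    refine absurd hlt (not_lt.2 ?_)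
    calc #L ≤ _ := mk_le_mk_of_subset hcov
      _ ≤ _ := mk_iUnion_le _
      _ ≤ κ * κ := by
          refine mul_le_mul' hT.le (ciSup_le' fun x => ?_)
          refine mk_insert_le.trans ?_
          exact (add_le_add (hTL x.2).2.le (one_le_aleph0.trans hκ)).trans (add_eq_self hκ).le
      _ = κ := mul_eq_self hκ

/-- A subset of a linear order of size more than `κ` has a point with at least `κ` elements
on either side. -/
theorem exists_le_mk_lt_and_le_mk_gt {J : Type u} [LinearOrder J] (S : Set J) {κ : Cardinal.{u}}
    (hκ : ℵ₀ ≤ κ) (hS : κ < #S) :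
    ∃ t ∈ S, κ ≤ #{s | s ∈ S ∧ s < t} ∧ κ ≤ #{s | s ∈ S ∧ t < s} := by
  by_contra! h
  have hcov : S ⊆ {t | t ∈ S ∧ #{s | s ∈ S ∧ s < t} < κ} ∪
      {t | t ∈ S ∧ #{s | s ∈ S ∧ t < s} < κ} := by
    intro t ht
    by_cases hlt : #{s | s ∈ S ∧ s < t} < κ
    · exact Or.inl ⟨ht, hlt⟩
    · exact Or.inr ⟨ht, h t ht (not_lt.1 hlt)⟩
  refine absurd hS (not_lt.2 ?_)
  calc #S ≤ _ := mk_le_mk_of_subset hcov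
    _ ≤ _ := mk_union_le _ _
    _ ≤ κ + κ := add_le_add (mk_setOf_mk_predecessors_lt_le S hκ)
        (mk_setOf_mk_predecessors_lt_le (J := Jᵒᵈ) S hκ)
    _ = κ := add_eq_self hκ

/-- A set of size at least `ℵ_{α+1}` has a subset of the same lower bound on its size on which a
given function with countable codomain is constant. -/
theorem exists_subset_aleph_le_mk_const {J : Type u} {I : Type} [Countable I] (S : Set J)
    (α : Ordinal.{u}) (hS : ℵ_ (α + 1) ≤ #S) (f : J → I) :
    ∃ T ⊆ S, ℵ_ (α + 1) ≤ #T ∧ ∃ v, ∀ s ∈ T, f s = v := by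
  obtain ⟨v, T, hTS, hT, hv⟩ := infinite_pigeonhole_set (s := S)
    (fun s => (ULift.up.{u} (f s))) _ hS (aleph0_le_aleph _) (by
      rw [(isRegular_aleph_add_one α).cof_ord]
      refine (mk_le_aleph0 (α := ULift.{u} I)).trans_lt ?_
      rw [← aleph_zero, aleph_lt_aleph]
      exact Order.bot_lt_succ α)
  exact ⟨T, hTS, hT, v.down, fun s hs => congrArg ULift.down (hv hs)⟩

/-- Fusion: suppose that configurations of stage `n` and level `α < ω₁` carry countably valued
invariants `info 0, …, info n`, that lowering the level is harmless, and that a configuration of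
level `α + 1` extends to the next stage at level `α` without changing its invariants. Then a single
sequence of invariants is realized at all stages and all levels. -/
theorem exists_forall_realized {X : Type u} {I : ℕ → Type} [∀ n, Countable (I n)]
    (K : ℕ → Ordinal.{u} → Set X) (info : ∀ n, X → I n)
    (hmono : ∀ n α β, α ≤ β → K n β ⊆ K n α)
    (hzero : ∃ x, ∀ α < Ordinal.omega 1, x ∈ K 0 α)
    (hstep : ∀ n α, ∀ x ∈ K n (α + 1), ∃ y ∈ K (n + 1) α, ∀ m ≤ n, info m y = info m x) :
    ∃ v : ∀ n, I n, ∀ n, ∀ α < Ordinal.omega 1, ∃ x ∈ K n α, ∀ m ≤ n, info m x = v m := by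
  let Good (n : ℕ) (v : ∀ n, I n) : Prop :=
    ∀ α < Ordinal.omega 1, ∃ x ∈ K n α, ∀ m ≤ n, info m x = v m
  have hnext (n : ℕ) (v : ∀ n, I n) (hv : Good n v) :
      ∃ w, Good (n + 1) w ∧ ∀ m ≤ n, w m = v m := by
    by_contra! hno
    have hbad (z : I (n + 1)) : ∃ γ < Ordinal.omega 1, ∀ x ∈ K (n + 1) γ,
        (∀ m ≤ n, info m x = v m) → info (n + 1) x ≠ z := by
      by_contra! hz
      obtain ⟨m, hm, hne⟩ := hno (Function.update v (n + 1) z) (by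
        intro α hα
        obtain ⟨x, hx, hxv, hxz⟩ := hz α hα
        refine ⟨x, hx, fun m hm => ?_⟩
        rcases hm.eq_or_lt with rfl | hm
        · simpa using hxz
        · rw [Function.update_of_ne hm.ne, hxv m (Nat.le_of_lt_succ hm)])
      exact hne (Function.update_of_ne (by omega) _ _)
    choose γ hγ hγz using hbad
    have hsup : ⨆ z, γ z < Ordinal.omega 1 := Ordinal.iSup_lt_omega_one hγ
    obtain ⟨x, hx, hxv⟩ := hv _ ((isSuccLimit_omega 1).succ_lt hsup)
    obtain ⟨y, hy, hyx⟩ := hstep n _ x hx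
    exact hγz (info (n + 1) y) y (hmono _ _ _ (Ordinal.le_iSup γ _) hy)
      (fun m hm => (hyx m hm).trans (hxv m hm)) rfl
  choose next hnext hagree using hnext
  obtain ⟨x₀, hx₀⟩ := hzero
  have hv₀ : Good 0 fun n => info n x₀ := fun α hα => ⟨x₀, hx₀ α hα, fun _ _ => rfl⟩
  let seq : ∀ n, {v // Good n v} := fun n => Nat.rec ⟨_, hv₀⟩
    (fun n v => ⟨next n v.1 v.2, hnext n v.1 v.2⟩) n
  have hseq (n m : ℕ) (hm : m ≤ n) : (seq n).1 m = (seq m).1 m := by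
    induction n, hm using Nat.le_induction with
    | base => rfl
    | succ n hn ih => exact (hagree n _ (seq n).2 m hn).trans ih
  refine ⟨fun n => (seq n).1 n, fun n α hα => ?_⟩
  obtain ⟨x, hx, hxv⟩ := (seq n).2 α hα
  exact ⟨x, hx, fun m hm => (hxv m hm).trans (hseq n m hm)⟩

/-- The initial segment of length `n` of a binary sequence. -/
def initialSegment (η : ℕ → Bool) (n : ℕ) : List Bool := (List.range n).map η

@[simp]
theorem length_initialSegment (η : ℕ → Bool) (n : ℕ) : (initialSegment η n).length = n := by
  simp [initialSegment]

theorem take_initialSegment (η : ℕ → Bool) {k n : ℕ} (h : k ≤ n) :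
    (initialSegment η n).take k = initialSegment η k := by
  simp [initialSegment, ← List.map_take, List.take_range, h]

theorem getD_initialSegment (η : ℕ → Bool) {k n : ℕ} (h : k < n) :
    (initialSegment η n).getD k false = η k := by
  simp [initialSegment, h]

theorem eq_initialSegment (ν : List Bool) (η : ℕ → Bool)
    (h : ∀ j (hj : j < ν.length), η j = ν.get ⟨j, hj⟩) : ν = initialSegment η ν.length := by
  refine List.ext_getElem (by simp) fun j hj _ => ?_
  simpa [initialSegment] using (h j hj).symm

/-- `s` lies below `t` if `i = false`, and above `t` if `i = true`. -/
def OnSide {J : Type u} [LinearOrder J] (i : Bool) (s t : J) : Prop :=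
  if i then t < s else s < t

/-- A binary splitting of subsets of `J`: the nodes `ν` of a given level `n` carry sets `leaf ν`,
the nodes below that level carry the points `cut ν` at which they were split, and `rep ν` is a
point representing the finite information decided at `ν`. -/
structure Splitting (J : Type u) where
  /-- the splitting point of a node -/
  cut : List Bool → J
  /-- the point representing a node -/
  rep : List Bool → J
  /-- the set of candidates at a node -/
  leaf : List Bool → Set J

section Splitting

variable {J : Type u}

/-- The finite information decided by the point `s` at the node `l` at stage `n`. -/
def nodeInfo (c : J → ℕ → ℕ) (W : J → J → ℕ → ℕ) (cut : List Bool → J) (n : ℕ)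
    (l : List Bool) (s : J) : Fin n → ℕ × (Fin n → ℕ × ℕ) :=
  fun j => (c s j, fun k => (W s (cut (l.take k)) j, c (cut (l.take k)) j))

/-- The finite information decided by the splitting at stage `n`. -/
def Splitting.info (c : J → ℕ → ℕ) (W : J → J → ℕ → ℕ) (n : ℕ) (x : Splitting J) :
    {l : List Bool // l.length = n} → Fin n → ℕ × (Fin n → ℕ × ℕ) :=
  fun l => nodeInfo c W x.cut n l (x.rep l)

/-- `x` is a splitting of depth `n` whose leaves have size at least `ℵ_{α+1}`. -/
structure Splitting.Valid [LinearOrder J] (c : J → ℕ → ℕ) (W : J → J → ℕ → ℕ)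
    (n : ℕ) (α : Ordinal.{u}) (x : Splitting J) : Prop where
  card : ∀ l : List Bool, l.length = n → ℵ_ (α + 1) ≤ #(x.leaf l)
  side : ∀ l : List Bool, l.length = n → ∀ s ∈ x.leaf l, ∀ k < n,
    OnSide (l.getD k false) s (x.cut (l.take k))
  const : ∀ l : List Bool, l.length = n → ∀ s ∈ x.leaf l, ∀ m ≤ n,
    nodeInfo c W x.cut m (l.take m) s = nodeInfo c W x.cut m (l.take m) (x.rep (l.take m))

theorem nodeInfo_congr (c : J → ℕ → ℕ) (W : J → J → ℕ → ℕ) {cut cut' : List Bool → J} {n : ℕ}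
    (h : ∀ l : List Bool, l.length < n → cut l = cut' l) (l : List Bool) (s : J) :
    nodeInfo c W cut n l s = nodeInfo c W cut' n l s := by
  have (k : Fin n) : cut (l.take k) = cut' (l.take k) :=
    h _ ((List.length_take_le _ _).trans_lt k.2)
  unfold nodeInfo
  simp only [this]

theorem nodeInfo_take (c : J → ℕ → ℕ) (W : J → J → ℕ → ℕ) (cut : List Bool → J) (n : ℕ)
    (l : List Bool) (s : J) :
    nodeInfo c W cut (n + 1) (l.take n) s = nodeInfo c W cut (n + 1) l s := by
  have (k : Fin (n + 1)) : (l.take n).take k = l.take k := by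
    rw [List.take_take, min_eq_left (Nat.le_of_lt_succ k.2)]
  unfold nodeInfo
  simp only [this]

theorem Splitting.Valid.exists_extension [LinearOrder J] {c : J → ℕ → ℕ} {W : J → J → ℕ → ℕ}
    {n : ℕ} {α : Ordinal.{u}} {x : Splitting J} (hx : x.Valid c W n (α + 1)) :
    ∃ y : Splitting J, y.Valid c W (n + 1) α ∧ ∀ m ≤ n, y.info c W m = x.info c W m := by
  have hcut (l : List Bool) : ∃ t, l.length = n →
      ∀ i, ℵ_ (α + 1) ≤ #{s | s ∈ x.leaf l ∧ OnSide i s t} := by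
    by_cases hl : l.length = n
    · obtain ⟨t, -, hlt, hgt⟩ := exists_le_mk_lt_and_le_mk_gt (x.leaf l)
        (aleph0_le_aleph (α + 1))
        ((aleph_lt_aleph.2 (Order.lt_succ _)).trans_le (hx.card l hl))
      exact ⟨t, fun _ i => by cases i <;> simpa [OnSide]⟩
    · exact ⟨x.cut l, fun h => absurd h hl⟩
  choose t ht using hcut
  let cut' : List Bool → J := fun l => if l.length = n then t l else x.cut l
  have hthin (l : List Bool) (i : Bool) : ∃ (T : Set J) (r : J), l.length = n →
      T ⊆ {s | s ∈ x.leaf l ∧ OnSide i s (t l)} ∧ ℵ_ (α + 1) ≤ #T ∧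
      ∀ s ∈ T, nodeInfo c W cut' (n + 1) l s = nodeInfo c W cut' (n + 1) l r := by
    by_cases hl : l.length = n
    · obtain ⟨T, hTS, hT, v, hv⟩ := exists_subset_aleph_le_mk_const _ α (ht l hl i)
        (nodeInfo c W cut' (n + 1) l)
      have hne : T.Nonempty := by
        rw [← Set.nonempty_coe_sort, ← mk_ne_zero_iff]
        exact ((aleph_pos _).trans_le hT).ne'
      obtain ⟨r, hr⟩ := hne
      exact ⟨T, r, fun _ => ⟨hTS, hT, fun s hs => (hv s hs).trans (hv r hr).symm⟩⟩
    · exact ⟨∅, t l, fun h => absurd h hl⟩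
  choose T r hTr using hthin
  let y : Splitting J :=
    { cut := cut'
      rep := fun l => if l.length = n + 1 then r (l.take n) (l.getD n false) else x.rep l
      leaf := fun l => T (l.take n) (l.getD n false) }
  have hcut' (l : List Bool) (hl : l.length < n) : cut' l = x.cut l := if_neg hl.ne
  have hrep (l : List Bool) (hl : l.length ≤ n) : y.rep l = x.rep l := if_neg (by omega)
  refine ⟨y, ⟨fun l hl => ?_, fun l hl s hs k hk => ?_, fun l hl s hs m hm => ?_⟩, fun m hm => ?_⟩
  · exact (hTr (l.take n) _ (by simp [hl])).2.1
  · have hlen : (l.take n).length = n := by simp [hl]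
    have hs' := (hTr (l.take n) _ hlen).1 hs
    rcases (Nat.le_of_lt_succ hk).eq_or_lt with rfl | hk
    · simpa [y, cut', hlen] using hs'.2
    · have := hx.side _ hlen s hs'.1 k hk
      have hlk : (l.take k).length < n := by simp [hl]; omega
      simp only [y]
      rw [hcut' _ hlk]
      simpa [List.take_take, hk, hk.le] using this
  · have hlen : (l.take n).length = n := by simp [hl]
    have hs' := (hTr (l.take n) _ hlen).1 hs
    rcases hm.eq_or_lt with rfl | hm
    · have := (hTr (l.take n) _ hlen).2.2 s hs
      rw [nodeInfo_take, nodeInfo_take] at this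
      rw [List.take_of_length_le hl.le]
      simpa [y, hl] using this
    · have hm := Nat.le_of_lt_succ hm
      have := hx.const _ hlen s hs'.1 m hm
      rw [List.take_take, min_eq_left hm] at this
      have hc (l : List Bool) (hl : l.length < m) : cut' l = x.cut l := hcut' l (hl.trans_le hm)
      rw [hrep _ (by simp; omega)]
      simp only [y]
      rwa [nodeInfo_congr c W hc, nodeInfo_congr c W hc]
  · funext l
    have hc (l : List Bool) (hl : l.length < m) : cut' l = x.cut l := hcut' l (hl.trans_le hm)
    simp only [Splitting.info]
    rw [hrep _ (by rw [l.2]; exact hm)]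
    exact nodeInfo_congr c W hc _ _

/-- Binary trees through closed relations from long linear orders: the points of `J` are coded by
`c`, and `W s t` codes a witness for the position of `s` relative to `t`. -/
theorem exists_binary_tree_of_closed [LinearOrder J] (hJ : ℵ_ (Ordinal.omega 1) ≤ #J)
    (F : Bool → Set ((ℕ → ℕ) × (ℕ → ℕ) × (ℕ → ℕ))) (hF : ∀ i, IsClosed (F i))
    (c : J → ℕ → ℕ) (W : J → J → ℕ → ℕ)
    (hW : ∀ i s t, OnSide i s t → (W s t, c s, c t) ∈ F i) :
    ∃ (C : (ℕ → Bool) → ℕ → ℕ) (d : List Bool → ℕ → ℕ), ∀ η k,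
      ∃ w, (w, C η, d (initialSegment η k)) ∈ F (η k) := by
  have hfin (n : ℕ) : Finite {l : List Bool // l.length = n} := List.finite_length_eq Bool n
  obtain ⟨v, hv⟩ := exists_forall_realized (X := Splitting J)
    (fun n α => {x | x.Valid c W n α}) (Splitting.info c W)
    (fun n α β h x hx => ⟨fun l hl => (aleph_le_aleph.2 (by gcongr)).trans (hx.card l hl),
      hx.side, hx.const⟩)
    (by
      have : Nonempty J := mk_ne_zero_iff.1 ((aleph_pos _).trans_le hJ).ne'
      let j : J := Classical.arbitrary J
      refine ⟨⟨fun _ => j, fun _ => j, fun _ => Set.univ⟩, fun α hα => ⟨fun l _ => ?_, ?_, ?_⟩⟩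
      · rw [mk_univ]
        exact (aleph_le_aleph.2 (Order.succ_le_of_lt hα)).trans hJ
      · intro l _ s _ k hk
        omega
      · intro l _ s _ m hm
        obtain rfl : m = 0 := by omega
        exact Subsingleton.elim _ _)
    (fun n α x hx => hx.exists_extension)
  let C : (ℕ → Bool) → ℕ → ℕ := fun η j =>
    (v (j + 1) ⟨initialSegment η (j + 1), by simp⟩ (Fin.last j)).1
  let pad : List Bool → ℕ → Bool := fun ν j => ν.getD j false
  let d : List Bool → ℕ → ℕ := fun ν j => ((v (ν.length + j + 1)
    ⟨initialSegment (pad ν) (ν.length + j + 1), by simp⟩ ⟨j, by omega⟩).2 ⟨ν.length, by omega⟩).2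
  let w : (ℕ → Bool) → ℕ → ℕ → ℕ := fun η k j => ((v (k + j + 1)
    ⟨initialSegment η (k + j + 1), by simp⟩ ⟨j, by omega⟩).2 ⟨k, by omega⟩).1
  refine ⟨C, d, fun η k => ⟨w η k, ?_⟩⟩
  have happrox (n : ℕ) : ∃ s t, OnSide (η k) s t ∧
      ∀ j < n, W s t j = w η k j ∧ c s j = C η j ∧ c t j = d (initialSegment η k) j := by
    obtain ⟨x, hx, hxv⟩ := hv (k + n + 1) 0 (Ordinal.omega_pos 1)
    let l := initialSegment η (k + n + 1)
    have hl : l.length = k + n + 1 := by simp [l]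
    have hne : (x.leaf l).Nonempty := by
      rw [← Set.nonempty_coe_sort, ← mk_ne_zero_iff]
      exact ((aleph_pos _).trans_le (hx.card l hl)).ne'
    obtain ⟨s, hs⟩ := hne
    have hinfo (m : ℕ) (hm : m ≤ k + n + 1) :
        nodeInfo c W x.cut m (initialSegment η m) s = v m ⟨initialSegment η m, by simp⟩ := by
      have := hx.const l hl s hs m hm
      rw [take_initialSegment η hm] at this
      rw [this, ← hxv m hm]
      rfl
    refine ⟨s, x.cut (initialSegment η k), ?_, fun j hj => ⟨?_, ?_, ?_⟩⟩
    · have := hx.side l hl s hs k (by omega)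
      rwa [getD_initialSegment η (by omega), take_initialSegment η (by omega)] at this
    · simp only [w]
      rw [← hinfo _ (by omega)]
      simp [nodeInfo, take_initialSegment η (show k ≤ k + j + 1 by omega)]
    · simp only [C]
      rw [← hinfo _ (by omega)]
      simp [nodeInfo]
    · have hpad : initialSegment (pad (initialSegment η k)) k = initialSegment η k := by
        refine List.map_congr_left fun i hi => ?_
        exact getD_initialSegment η (List.mem_range.1 hi)
      simp only [d]
      rw [← hxv _ (by rw [length_initialSegment]; omega)]
      simp [Splitting.info, nodeInfo, take_initialSegment _
        (show k ≤ k + j + 1 by omega), hpad]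
  choose s t hside hagree using happrox
  have hlim {f : ℕ → ℕ → ℕ} {g : ℕ → ℕ} (h : ∀ n, ∀ j < n, f n j = g j) :
      Filter.Tendsto f Filter.atTop (nhds g) := by
    refine tendsto_pi_nhds.2 fun j => tendsto_const_nhds.congr' ?_
    filter_upwards [Filter.eventually_gt_atTop j] with n hn using (h n j hn).symm
  exact (hF (η k)).mem_of_tendsto
    ((hlim fun n j hj => (hagree n j hj).1).prodMk_nhds
      ((hlim fun n j hj => (hagree n j hj).2.1).prodMk_nhds
        (hlim fun n j hj => (hagree n j hj).2.2)))
    (Filter.Eventually.of_forall fun n => hW _ _ _ (hside n))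

end Splitting

/-- From a long linear order inside a pair of contradictory analytic relations on `ℝ^m`
one obtains a perfect (Cantor-indexed) family of explicitly contradictory elements:
if `R₀, R₁ ⊆ ℝ^m × ℝ^m` are analytic and contradictory and some linear order `J` of
cardinality at least `ℵ_{ω₁}` is realized by `⟨a_t : t ∈ J⟩` (i.e. `s < t` implies
`(a_s,a_t) ∈ R₀` and `(a_t,a_s) ∈ R₁`), then there are `a_η` (`η ∈ 2^ω`) and `b_ν`
(`ν ∈ 2^{<ω}`) such that whenever `η` extends `ν⌢⟨i⟩` we have `(a_η, b_ν) ∈ R_i`;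
in particular the `a_η` are pairwise distinct. -/
theorem analytic_order_implies_unstable
    (m : ℕ) (R₀ R₁ : Set ((Fin m → ℝ) × (Fin m → ℝ)))
    (h₀ : AnalyticSet R₀) (h₁ : AnalyticSet R₁)
    (hcontra : ∀ b : Fin m → ℝ, ¬ ∃ a : Fin m → ℝ, (a, b) ∈ R₀ ∧ (a, b) ∈ R₁)
    (J : Type u) [LinearOrder J]
    (hJ : Cardinal.aleph (Ordinal.omega 1) ≤ Cardinal.mk J)
    (a : J → (Fin m → ℝ))
    (ha : ∀ s t : J, s < t → (a s, a t) ∈ R₀ ∧ (a t, a s) ∈ R₁) :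
    ∃ (A : (ℕ → Bool) → (Fin m → ℝ)) (b : List Bool → (Fin m → ℝ)),
      (∀ (ν : List Bool) (i : Bool) (η : ℕ → Bool),
        (∀ j (hj : j < ν.length), η j = ν.get ⟨j, hj⟩) → η ν.length = i →
        (A η, b ν) ∈ (if i then R₁ else R₀)) ∧
      Function.Injective A := by
  have hinf : ℵ₀ ≤ #J := (aleph0_le_aleph _).trans hJ
  have : Infinite J := infinite_iff.2 hinf
  obtain ⟨s₀, t₀, hst⟩ := exists_pair_lt J
  have hR (i : Bool) : ∃ f : (ℕ → ℕ) → (Fin m → ℝ) × (Fin m → ℝ), Continuous f ∧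
      Set.range f = if i then R₁ else R₀ := by
    cases i
    · rw [AnalyticSet] at h₀
      exact h₀.resolve_left (Set.nonempty_iff_ne_empty.1 ⟨_, (ha _ _ hst).1⟩)
    · rw [AnalyticSet] at h₁
      exact h₁.resolve_left (Set.nonempty_iff_ne_empty.1 ⟨_, (ha _ _ hst).2⟩)
  choose f hf hrange using hR
  obtain ⟨g, hg, hgsurj⟩ :=
    exists_nat_nat_continuous_surjective_of_completeSpace (Fin m → ℝ)
  choose c hc using fun s => hgsurj (a s)
  have hwit (s t : J) : ∃ w : ℕ → ℕ, ∀ i, OnSide i s t → f i w = (a s, a t) := by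
    rcases lt_trichotomy s t with h | rfl | h
    · obtain ⟨w, hw⟩ : (a s, a t) ∈ Set.range (f false) := by
        rw [hrange]
        exact (ha _ _ h).1
      exact ⟨w, fun i hi => by cases i <;> simp_all [OnSide, h.not_gt]⟩
    · exact ⟨0, fun i hi => by cases i <;> simp [OnSide] at hi⟩
    · obtain ⟨w, hw⟩ : (a s, a t) ∈ Set.range (f true) := by
        rw [hrange]
        exact (ha _ _ h).2
      exact ⟨w, fun i hi => by cases i <;> simp_all [OnSide, h.not_gt]⟩
  choose W hW using hwit
  obtain ⟨C, d, hCd⟩ := exists_binary_tree_of_closed hJ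
    (fun i => {q | f i q.1 = (g q.2.1, g q.2.2)})
    (fun i => isClosed_eq (by fun_prop) (by fun_prop)) c W
    (fun i s t h => by simp [hW s t i h, hc])
  have hmem (η : ℕ → Bool) (k : ℕ) :
      (g (C η), g (d (initialSegment η k))) ∈ if η k then R₁ else R₀ := by
    obtain ⟨w, hw⟩ := hCd η k
    rw [← hrange]
    exact ⟨w, hw⟩
  refine ⟨fun η => g (C η), fun ν => g (d ν), fun ν i η hν hi => ?_, fun η η' hηη' => ?_⟩
  · subst hi
    have := hmem η ν.length
    rwa [← eq_initialSegment ν η hν] at this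
  · funext k
    induction k using Nat.strong_induction_on with
    | _ k ih =>
      have hseg : initialSegment η k = initialSegment η' k :=
        List.map_congr_left fun j hj => ih j (List.mem_range.1 hj)
      have h := hmem η k
      have h' := hmem η' k
      rw [← hseg, ← show g (C η) = g (C η') from hηη'] at h'
      by_contra hne
      cases hη : η k <;> cases hη' : η' k <;> simp only [hη, hη'] at h h' hne
      · exact hne trivial
      · exact hcontra _ ⟨_, h, h'⟩
      · exact hcontra _ ⟨_, h', h⟩
      · exact hne trivial
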